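/- Let a_1, a_2 be nonzero integers and b an integer, and let A be the 1×2 matrix (a_1 a_2). Suppose that a_1x_1+a_2x_2 = b has a solution in two distinct positive integers and that a_1x_1+a_2x_2 = 0 has a solution in two distinct positive integers. Then: if p = p(n) satisfies p·n^{1/3} → ∞, with high probability Maker wins the (A,b)-game on [n]_p; and if p·n^{1/3} → 0, with high probability Breaker wins the (A,b)-game on [n]_p. -/

import Mathlib

variable {V : Type*} [DecidableEq V]

/-- Maker has a winning strategy in the Maker-Breaker game, given whose turn it is
(`true` = Maker to move), the remaining unclaimed board `R`, and Maker's current set `M`.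
Maker wins if at the end of the game (all elements claimed) her set satisfies `win`. -/
def makerWinsAux (win : Finset V → Prop) : Bool → Finset V → Finset V → Prop
  | true, R, M =>
      if R.Nonempty then ∃ x, ∃ _h : x ∈ R, makerWinsAux win false (R.erase x) (insert x M)
      else win M
  | false, R, M =>
      if R.Nonempty then ∀ x, x ∈ R → makerWinsAux win true (R.erase x) M
      else win M
termination_by _ R _ => R.card
decreasing_by
  · exact Finset.card_erase_lt_of_mem ‹x ∈ R›
  · exact Finset.card_erase_lt_of_mem ‹x ∈ R›

/-- Breaker has a winning strategy (Maker moves first). -/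
def breakerWinsAux (win : Finset V → Prop) : Bool → Finset V → Finset V → Prop
  | true, R, M =>
      if R.Nonempty then ∀ x, x ∈ R → breakerWinsAux win false (R.erase x) (insert x M)
      else ¬ win M
  | false, R, M =>
      if R.Nonempty then ∃ x, ∃ _h : x ∈ R, breakerWinsAux win true (R.erase x) M
      else ¬ win M
termination_by _ R _ => R.card
decreasing_by
  · exact Finset.card_erase_lt_of_mem ‹x ∈ R›
  · exact Finset.card_erase_lt_of_mem ‹x ∈ R›

/-- Maker wins the Maker-Breaker game on board `X` with winning condition `win`. -/
def MakerWins (win : Finset V → Prop) (X : Finset V) : Prop := makerWinsAux win true X ∅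

/-- Breaker wins the Maker-Breaker game on board `X` with winning condition `win`. -/
def BreakerWins (win : Finset V → Prop) (X : Finset V) : Prop := breakerWinsAux win true X ∅

/-- Maker's winning condition in the `(A,b)`-game: her claimed set `M` contains all entries of
some `k`-distinct solution (in positive integers) of `A x = b`. -/
def RadoWin {l k : ℕ} (A : Matrix (Fin l) (Fin k) ℤ) (b : Fin l → ℤ) (M : Finset ℕ) : Prop :=
  ∃ x : Fin k → ℕ, Function.Injective x ∧ (∀ i, x i ∈ M) ∧
    A.mulVec (fun i => (x i : ℤ)) = b

/-- The pair `(A,b)` is irredundant: `A x = b` has a `k`-distinct solution in positive integers. -/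
def PairIrredundant {l k : ℕ} (A : Matrix (Fin l) (Fin k) ℤ) (b : Fin l → ℤ) : Prop :=
  ∃ x : Fin k → ℕ, Function.Injective x ∧ (∀ i, 0 < x i) ∧
    A.mulVec (fun i => (x i : ℤ)) = b

/-- The matrix `A` is irredundant: `A x = 0` has a `k`-distinct solution in positive integers. -/
def MatIrredundant {l k : ℕ} (A : Matrix (Fin l) (Fin k) ℤ) : Prop :=
  PairIrredundant A 0

/-- Property (*): no rational linear combination of the rows of `A` has exactly two
nonzero entries. -/
def PropertyStar {l k : ℕ} (A : Matrix (Fin l) (Fin k) ℤ) : Prop :=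
  ∀ c : Fin l → ℚ,
    (Finset.univ.filter fun j : Fin k => (∑ i, c i * (A i j : ℚ)) ≠ 0).card ≠ 2

/-- The rank (over `ℚ`) of an integer matrix. -/
noncomputable def rankQ {l k : ℕ} (A : Matrix (Fin l) (Fin k) ℤ) : ℕ :=
  (A.map (Int.cast : ℤ → ℚ)).rank

/-- The rank (over `ℚ`) of the matrix `A_{W̄}` formed by the columns of `A` indexed by the
complement of `W`. -/
noncomputable def rankRestrict {l k : ℕ} (A : Matrix (Fin l) (Fin k) ℤ)
    (W : Finset (Fin k)) : ℕ :=
  ((A.map (Int.cast : ℤ → ℚ)).submatrix id (fun j : {j : Fin k // j ∈ Wᶜ} => j.1)).rank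

/-- The parameter `m(A)`. -/
noncomputable def mIndex {l k : ℕ} (A : Matrix (Fin l) (Fin k) ℤ) : ℝ :=
  sSup {x : ℝ | ∃ W : Finset (Fin k), 2 ≤ W.card ∧
    x = ((W.card : ℝ) - 1) / (((W.card : ℝ) - 1) + (rankRestrict A W : ℝ) - (rankQ A : ℝ))}

/-- `A` (an `ℓ×k` matrix of full rank `ℓ`) is strictly balanced. -/
def StrictlyBalanced {l k : ℕ} (A : Matrix (Fin l) (Fin k) ℤ) : Prop :=
  ∀ W : Finset (Fin k), 2 ≤ W.card → W.card < k →
    ((W.card : ℝ) - 1) / (((W.card : ℝ) - 1) + (rankRestrict A W : ℝ) - (l : ℝ))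
      < ((k : ℝ) - 1) / ((k : ℝ) - 1 - (l : ℝ))

open Classical in
/-- `μ(n,A,b)`: the maximum size of a subset of `[n] = {1,…,n}` containing no `k`-distinct
solution to `A x = b`. -/
noncomputable def muMax {l k : ℕ} (n : ℕ) (A : Matrix (Fin l) (Fin k) ℤ) (b : Fin l → ℤ) : ℕ :=
  (((Finset.Icc 1 n).powerset.filter fun S => ¬ RadoWin A b S).sup Finset.card)

open Classical in
/-- The probability that the random subset `[n]_p` (each element of `{1,…,n}` included
independently with probability `p`) satisfies the property `P`. -/
noncomputable def probRandomSubset (n : ℕ) (p : ℝ) (P : Finset ℕ → Prop) : ℝ :=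
  ∑ S ∈ (Finset.Icc 1 n).powerset,
    if P S then p ^ S.card * (1 - p) ^ (n - S.card) else 0

/-- Maker wins the `(A,b)`-game on the board `X` (Maker moves first). -/
def MakerWinsRado {l k : ℕ} (A : Matrix (Fin l) (Fin k) ℤ) (b : Fin l → ℤ)
    (X : Finset ℕ) : Prop :=
  MakerWins (RadoWin A b) X

/-- Breaker wins the `(A,b)`-game on the board `X` (Maker moves first). -/
def BreakerWinsRado {l k : ℕ} (A : Matrix (Fin l) (Fin k) ℤ) (b : Fin l → ℤ)
    (X : Finset ℕ) : Prop :=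
  BreakerWins (RadoWin A b) X

section helpers

lemma radoWin_iff (a₁ a₂ b : ℤ) (M : Finset ℕ) :
    RadoWin (Matrix.of fun _ : Fin 1 => ![a₁, a₂]) (fun _ => b) M ↔
      ∃ x ∈ M, ∃ y ∈ M, x ≠ y ∧ a₁ * (x : ℤ) + a₂ * (y : ℤ) = b := by
  constructor
  · rintro ⟨x, hx, hM, h⟩
    refine ⟨x 0, hM 0, x 1, hM 1, fun h => by simpa using hx h, ?_⟩
    have := congrFun h 0
    simpa [Matrix.mulVec, dotProduct, Fin.sum_univ_two] using this
  · rintro ⟨x, hx, y, hy, hne, h⟩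
    refine ⟨![x, y], ?_, ?_, ?_⟩
    · intro i j hij
      fin_cases i <;> fin_cases j <;> simp_all
    · intro i
      fin_cases i <;> simp_all
    · funext i
      simpa [Matrix.mulVec, dotProduct, Fin.sum_univ_two] using h

lemma makerWinsAux_of_win {win : Finset ℕ → Prop}
    (hmono : ∀ M M', M ⊆ M' → win M → win M') :
    ∀ (k : ℕ) (t : Bool) (R M : Finset ℕ), R.card = k → win M → makerWinsAux win t R M := by
  intro k
  induction k with
  | zero =>
    intro t R M hR hM
    have : R = ∅ := Finset.card_eq_zero.mp hR
    subst this
    cases t <;> (rw [makerWinsAux]; simpa using hM)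
  | succ k ih =>
    intro t R M hR hM
    have hne : R.Nonempty := Finset.card_pos.mp (by omega)
    cases t
    · rw [makerWinsAux, if_pos hne]
      intro x hx
      exact ih _ _ _ (by rw [Finset.card_erase_of_mem hx]; omega) hM
    · rw [makerWinsAux, if_pos hne]
      obtain ⟨x, hx⟩ := hne
      exact ⟨x, hx, ih _ _ _ (by rw [Finset.card_erase_of_mem hx]; omega)
        (hmono _ _ (Finset.subset_insert _ _) hM)⟩

lemma makerWins_of_path {win : Finset ℕ → Prop}
    (hmono : ∀ M M', M ⊆ M' → win M → win M') (X : Finset ℕ) (x y z : ℕ)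
    (hx : x ∈ X) (hy : y ∈ X) (hz : z ∈ X) (hxy : x ≠ y) (hyz : y ≠ z) (hxz : x ≠ z)
    (h1 : win {x, y}) (h2 : win {y, z}) : MakerWins win X := by
  have key : ∀ (R : Finset ℕ) (u : ℕ), u ∈ R → win {u, y} → makerWinsAux win true R {y} := by
    intro R u hu hw
    rw [makerWinsAux, if_pos ⟨u, hu⟩]
    exact ⟨u, hu, makerWinsAux_of_win hmono _ _ _ _ rfl hw⟩
  rw [MakerWins, makerWinsAux, if_pos ⟨y, hy⟩]
  refine ⟨y, hy, ?_⟩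
  have hx' : x ∈ X.erase y := Finset.mem_erase.mpr ⟨hxy, hx⟩
  have hz' : z ∈ X.erase y := Finset.mem_erase.mpr ⟨hyz.symm, hz⟩
  rw [makerWinsAux, if_pos ⟨x, hx'⟩]
  intro w hw
  by_cases hwx : w = x
  · refine key _ z (Finset.mem_erase.mpr ⟨?_, hz'⟩) ?_
    · rw [hwx]; exact hxz.symm
    · rwa [Finset.pair_comm]
  · exact key _ x (Finset.mem_erase.mpr ⟨fun h => hwx h.symm, hx'⟩) h1

lemma breakerWinsAux_of_matching {win : Finset ℕ → Prop} (adj : ℕ → ℕ → Prop)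
    (hsymm : ∀ u v, adj u v → adj v u)
    (hirr : ∀ u, ¬ adj u u)
    (hwin : ∀ M, win M → ∃ u ∈ M, ∃ v ∈ M, adj u v) :
    ∀ (k : ℕ) (R M : Finset ℕ), R.card ≤ k →
      (∀ u ∈ M, ∀ v ∈ M, ¬ adj u v) → (∀ u ∈ R, ∀ v ∈ M, ¬ adj u v) →
      (∀ u ∈ R, ∀ v ∈ R, ∀ w ∈ R, adj u v → adj u w → v = w) →
      breakerWinsAux win true R M := by
  intro k
  induction k with
  | zero =>
    intro R M hR hM _ _
    have : R = ∅ := Finset.card_eq_zero.mp (by omega)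
    subst this
    rw [breakerWinsAux]
    simp only [Finset.not_nonempty_empty, if_false]
    intro hw
    obtain ⟨u, hu, v, hv, h⟩ := hwin M hw
    exact hM u hu v hv h
  | succ k ih =>
    intro R M hR hM hRM hRR
    rw [breakerWinsAux]
    split_ifs with hne
    swap
    · intro hw
      obtain ⟨u, hu, v, hv, h⟩ := hwin M hw
      exact hM u hu v hv h
    intro x hx
    have hM' : ∀ u ∈ insert x M, ∀ v ∈ insert x M, ¬ adj u v := by
      intro u hu v hv h
      rcases Finset.mem_insert.mp hu with hux | huM
      · rcases Finset.mem_insert.mp hv with hvx | hvM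
        · rw [hux, hvx] at h
          exact hirr _ h
        · rw [hux] at h
          exact hRM _ hx _ hvM h
      · rcases Finset.mem_insert.mp hv with hvx | hvM
        · rw [hvx] at h
          exact hRM _ hx _ huM (hsymm _ _ h)
        · exact hM _ huM _ hvM h
    rw [breakerWinsAux]
    split_ifs with hne'
    swap
    · intro hw
      obtain ⟨u, hu, v, hv, h⟩ := hwin _ hw
      exact hM' u hu v hv h
    have hex : ∃ w ∈ R.erase x, ∀ u ∈ R.erase x, adj u x → u = w := by
      by_cases h : ∃ w ∈ R.erase x, adj w x
      · obtain ⟨w, hw, hwx⟩ := h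
        exact ⟨w, hw, fun u hu hux => hRR x hx u (Finset.mem_of_mem_erase hu) w
          (Finset.mem_of_mem_erase hw) (hsymm _ _ hux) (hsymm _ _ hwx)⟩
      · obtain ⟨w, hw⟩ := hne'
        exact ⟨w, hw, fun u hu hux => absurd ⟨u, hu, hux⟩ h⟩
    obtain ⟨w, hw, hwu⟩ := hex
    refine ⟨w, hw, ih _ _ ?_ hM' ?_ ?_⟩
    · have h1 := Finset.card_erase_lt_of_mem hx
      have h2 := Finset.card_erase_lt_of_mem hw
      omega
    · intro u hu v hv h
      rw [Finset.mem_erase] at hu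
      rcases Finset.mem_insert.mp hv with rfl | hv
      · exact hu.1 (hwu u hu.2 h)
      · exact hRM _ (Finset.mem_of_mem_erase hu.2) _ hv h
    · intro u hu v hv t ht
      exact hRR u (Finset.mem_of_mem_erase (Finset.mem_of_mem_erase hu)) v
        (Finset.mem_of_mem_erase (Finset.mem_of_mem_erase hv)) t
        (Finset.mem_of_mem_erase (Finset.mem_of_mem_erase ht))


lemma prob_superset (n : ℕ) (p : ℝ) (W : Finset ℕ) (hW : W ⊆ Finset.Icc 1 n) :
    probRandomSubset n p (fun S => W ⊆ S) = p ^ W.card := by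
  classical
  have h := Finset.prod_add (fun _ : ℕ => p) (fun i => if i ∈ W then (0 : ℝ) else 1 - p)
    (Finset.Icc 1 n)
  have hL : ∏ i ∈ Finset.Icc 1 n, (p + if i ∈ W then (0 : ℝ) else 1 - p) = p ^ W.card := by
    have : ∀ i ∈ Finset.Icc 1 n, (p + if i ∈ W then (0 : ℝ) else 1 - p) =
        if i ∈ W then p else 1 := by
      intro i _
      split_ifs <;> ring
    rw [Finset.prod_congr rfl this, Finset.prod_ite_mem, Finset.inter_eq_right.mpr hW,
      Finset.prod_const]
  rw [← hL, h, probRandomSubset]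
  refine Finset.sum_congr rfl fun S hS => ?_
  rw [Finset.mem_powerset] at hS
  rw [Finset.prod_const]
  split_ifs with hWS
  · congr 1
    have : ∀ i ∈ Finset.Icc 1 n \ S, (if i ∈ W then (0 : ℝ) else 1 - p) = 1 - p := by
      intro i hi
      rw [if_neg (fun hiW => (Finset.mem_sdiff.mp hi).2 (hWS hiW))]
    rw [Finset.prod_congr rfl this, Finset.prod_const, Finset.card_sdiff_of_subset hS]
    simp
  · obtain ⟨i, hiW, hiS⟩ := Finset.not_subset.mp hWS
    rw [Finset.prod_eq_zero (i := i) (Finset.mem_sdiff.mpr ⟨hW hiW, hiS⟩) (by simp [hiW]),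
      mul_zero]

lemma prob_true (n : ℕ) (p : ℝ) : probRandomSubset n p (fun _ => True) = 1 := by
  have := prob_superset n p ∅ (by simp)
  simpa using this

lemma wt_nonneg (n : ℕ) (p : ℝ) (h0 : 0 ≤ p) (h1 : p ≤ 1) (S : Finset ℕ) :
    0 ≤ p ^ S.card * (1 - p) ^ (n - S.card) :=
  mul_nonneg (pow_nonneg h0 _) (pow_nonneg (by linarith) _)

lemma prob_mono (n : ℕ) (p : ℝ) (h0 : 0 ≤ p) (h1 : p ≤ 1) (P Q : Finset ℕ → Prop)
    (h : ∀ S ⊆ Finset.Icc 1 n, P S → Q S) :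
    probRandomSubset n p P ≤ probRandomSubset n p Q := by
  classical
  refine Finset.sum_le_sum fun S hS => ?_
  have := wt_nonneg n p h0 h1 S
  have := h S (Finset.mem_powerset.mp hS)
  split_ifs <;> tauto

lemma prob_le_one (n : ℕ) (p : ℝ) (h0 : 0 ≤ p) (h1 : p ≤ 1) (P : Finset ℕ → Prop) :
    probRandomSubset n p P ≤ 1 := by
  rw [← prob_true n p]
  exact prob_mono n p h0 h1 _ _ (fun _ _ _ => trivial)

lemma prob_not (n : ℕ) (p : ℝ) (P : Finset ℕ → Prop) :
    probRandomSubset n p P = 1 - probRandomSubset n p (fun S => ¬ P S) := by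
  classical
  rw [eq_sub_iff_add_eq, ← prob_true n p, probRandomSubset, probRandomSubset, probRandomSubset,
    ← Finset.sum_add_distrib]
  refine Finset.sum_congr rfl fun S _ => ?_
  by_cases h : P S <;> simp [h]

lemma prob_union (n : ℕ) (p : ℝ) (h0 : 0 ≤ p) (h1 : p ≤ 1) (I : Finset ℕ)
    (P : ℕ → Finset ℕ → Prop) :
    probRandomSubset n p (fun S => ∃ i ∈ I, P i S) ≤
      ∑ i ∈ I, probRandomSubset n p (P i) := by
  classical
  simp only [probRandomSubset]
  rw [Finset.sum_comm]
  refine Finset.sum_le_sum fun S hS => ?_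
  have hw := wt_nonneg n p h0 h1 S
  split_ifs with h
  · obtain ⟨i, hi, hP⟩ := h
    refine le_trans ?_ (Finset.single_le_sum (f := fun i => if P i S then
      p ^ S.card * (1 - p) ^ (n - S.card) else 0) ?_ hi)
    · simp [hP]
    · intro j _
      split_ifs
      · exact hw
      · exact le_rfl
  · refine Finset.sum_nonneg fun j _ => ?_
    split_ifs
    · exact hw
    · exact le_rfl

lemma prob_none (n : ℕ) (p : ℝ) (N : ℕ) (T : ℕ → Finset ℕ)
    (hT : ∀ j < N, T j ⊆ Finset.Icc 1 n) (hc : ∀ j < N, (T j).card = 3)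
    (hd : ∀ i < N, ∀ j < N, i ≠ j → Disjoint (T i) (T j)) :
    probRandomSubset n p (fun S => ∀ j < N, ¬ T j ⊆ S) = (1 - p ^ 3) ^ N := by
  classical
  have hJ : ∀ J ∈ (Finset.range N).powerset,
      probRandomSubset n p (fun S => J.biUnion T ⊆ S) = (p ^ 3) ^ J.card := by
    intro J hJ
    rw [Finset.mem_powerset] at hJ
    have hJ' : ∀ j ∈ J, j < N := fun j hj => Finset.mem_range.mp (hJ hj)
    rw [prob_superset, Finset.card_biUnion, Finset.sum_congr rfl (fun j hj => hc j (hJ' j hj))]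
    · rw [Finset.sum_const, smul_eq_mul, mul_comm, pow_mul]
    · intro i hi j hj hij
      exact hd i (hJ' i hi) j (hJ' j hj) hij
    · exact Finset.biUnion_subset.mpr fun j hj => hT j (hJ' j hj)
  have hR : (1 - p ^ 3) ^ N = ∑ J ∈ (Finset.range N).powerset, (-1) ^ J.card *
      (p ^ 3) ^ J.card := by
    have := Finset.prod_add (fun _ : ℕ => -(p ^ 3)) (fun _ => (1 : ℝ)) (Finset.range N)
    simp only [Finset.prod_const, Finset.card_range, one_pow, mul_one] at this
    rw [show 1 - p ^ 3 = -(p ^ 3) + 1 by ring, this]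
    refine Finset.sum_congr rfl fun J _ => ?_
    rw [neg_pow]
  rw [hR, Finset.sum_congr rfl (fun J h => by rw [← hJ J h])]
  simp only [probRandomSubset, Finset.mul_sum]
  rw [Finset.sum_comm]
  refine Finset.sum_congr rfl fun S _ => ?_
  have hprod := Finset.prod_add (fun j : ℕ => -(if T j ⊆ S then (1 : ℝ) else 0))
    (fun _ => (1 : ℝ)) (Finset.range N)
  have hsum : ∑ J ∈ (Finset.range N).powerset, (-1 : ℝ) ^ J.card *
      (if J.biUnion T ⊆ S then p ^ S.card * (1 - p) ^ (n - S.card) else 0) =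
      (∏ j ∈ Finset.range N, (-(if T j ⊆ S then (1 : ℝ) else 0) + 1)) *
        (p ^ S.card * (1 - p) ^ (n - S.card)) := by
    rw [hprod, Finset.sum_mul]
    refine Finset.sum_congr rfl fun J _ => ?_
    rw [Finset.prod_neg]
    rw [Finset.prod_ite_zero]
    simp only [Finset.biUnion_subset, Finset.prod_const_one, mul_one]
    split_ifs <;> simp
  refine Eq.trans ?_ (hsum.symm.trans (Finset.sum_congr rfl fun J _ => by congr))
  split_ifs with h
  · rw [Finset.prod_eq_one, one_mul]
    intro j hj
    simp [h j (Finset.mem_range.mp hj)]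
  · push Not at h
    obtain ⟨j, hj, hjS⟩ := h
    rw [Finset.prod_eq_zero (Finset.mem_range.mpr hj) (by simp [hjS]), zero_mul]


lemma exists_base (a₁ a₂ b : ℤ) (h₁ : a₁ ≠ 0) (x y : ℤ) (h : a₁ * x + a₂ * y = b) :
    ∃ x0 y0 z0 : ℤ, a₁ * x0 + a₂ * y0 = b ∧ a₁ * y0 + a₂ * z0 = b := by
  obtain ⟨c₁, c₂, g, hg, h1, h2, u, v, huv⟩ : ∃ c₁ c₂ g : ℤ, g ≠ 0 ∧ a₁ = g * c₁ ∧ a₂ = g * c₂ ∧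
      IsCoprime c₁ c₂ := by
    have hg : 0 < Int.gcd a₁ a₂ := Int.gcd_pos_of_ne_zero_left _ h₁
    obtain ⟨c₁, c₂, hc, e1, e2⟩ := Int.exists_gcd_one hg
    exact ⟨c₁, c₂, Int.gcd a₁ a₂, by exact_mod_cast hg.ne', by rw [mul_comm]; exact e1,
      by rw [mul_comm]; exact e2, Int.isCoprime_iff_gcd_eq_one.mpr hc⟩
  subst h1 h2
  refine ⟨x + c₂ * (u * (y - x)), y - c₁ * (u * (y - x)), y - c₁ * (v * (y - x)), ?_, ?_⟩
  · linear_combination h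
  · linear_combination h - g * c₁ * (y - x) * huv

lemma triples_lt (a₁ a₂ b : ℤ) (h₁ : a₁ ≠ 0)
    (hAb : ∃ x y : ℤ, a₁ * x + a₂ * y = b) (X Y : ℤ) (hX : 0 < X) (hXY : X < Y)
    (h : a₁ * X + a₂ * Y = 0) :
    ∃ K N0 : ℕ, 0 < K ∧ ∀ N ≥ N0, ∃ x y z : ℕ → ℕ,
      (∀ j < N, 0 < x j ∧ z j ≤ K * N ∧
        a₁ * (x j : ℤ) + a₂ * (y j : ℤ) = b ∧ a₁ * (y j : ℤ) + a₂ * (z j : ℤ) = b) ∧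
      (∀ i < N, ∀ j < N, x i < y j ∧ y i < z j) ∧
      (∀ i < N, ∀ j < N, i ≠ j → x i ≠ x j ∧ y i ≠ y j ∧ z i ≠ z j) := by
  obtain ⟨ξ, η, hξ⟩ := hAb
  obtain ⟨x0, y0, z0, e1, e2⟩ := exists_base a₁ a₂ b h₁ ξ η hξ
  obtain ⟨C, hC⟩ : ∃ C : ℤ, C = |x0| + |y0| + |z0| := ⟨_, rfl⟩
  have := neg_abs_le x0
  have := neg_abs_le y0
  have := neg_abs_le z0
  have := le_abs_self x0
  have := le_abs_self y0
  have := le_abs_self z0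
  have := abs_nonneg x0
  have := abs_nonneg y0
  have := abs_nonneg z0
  have hY : 0 < Y := by omega
  have hYY : 1 ≤ Y * Y := by nlinarith
  have hXX : 1 ≤ X * X := by nlinarith
  have hXYp : 1 ≤ X * Y := by nlinarith
  refine ⟨(Y * Y * (2 * X + 1) + 1).toNat, (2 * C + 1).toNat, ?_, ?_⟩
  · have : 0 < Y * Y * (2 * X + 1) + 1 := by positivity
    omega
  intro N hN
  have hN' : 2 * C + 1 ≤ (N : ℤ) := by omega
  have bx : ∀ j : ℕ, j < N → X * X * (2 * X * N) - C ≤ x0 + X * X * (2 * X * N + j) ∧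
      x0 + X * X * (2 * X * N + j) ≤ X * X * (2 * X * N) + X * X * N + C := by
    intro j hj
    have : (j : ℤ) ≤ N := by omega
    have h1 : X * X * (j : ℤ) ≤ X * X * N := by gcongr
    have h2 : 0 ≤ X * X * (j : ℤ) := by positivity
    constructor <;> linarith
  have bY : ∀ j : ℕ, j < N → X * Y * (2 * X * N) - C ≤ y0 + X * Y * (2 * X * N + j) ∧
      y0 + X * Y * (2 * X * N + j) ≤ X * Y * (2 * X * N) + X * Y * N + C := by
    intro j hj
    have : (j : ℤ) ≤ N := by omega
    have h1 : X * Y * (j : ℤ) ≤ X * Y * N := by gcongr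
    have h2 : 0 ≤ X * Y * (j : ℤ) := by positivity
    constructor <;> linarith
  have bz : ∀ j : ℕ, j < N → Y * Y * (2 * X * N) - C ≤ z0 + Y * Y * (2 * X * N + j) ∧
      z0 + Y * Y * (2 * X * N + j) ≤ Y * Y * (2 * X * N) + Y * Y * N + C := by
    intro j hj
    have : (j : ℤ) ≤ N := by omega
    have h1 : Y * Y * (j : ℤ) ≤ Y * Y * N := by gcongr
    have h2 : 0 ≤ Y * Y * (j : ℤ) := by positivity
    constructor <;> linarith
  have hNN : (0 : ℤ) ≤ N := by positivity
  have k0 : 2 * (N : ℤ) ≤ X * X * (2 * X * N) := by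
    have : 1 ≤ X * X * X := by nlinarith
    nlinarith
  have k1 : X * X * (2 * X * N) + X * X * N + N ≤ X * Y * (2 * X * N) := by
    have : X * X * (N : ℤ) * (X + 1) ≤ X * X * N * Y := by gcongr; omega
    have : 1 * (N : ℤ) ≤ X * X * N := by gcongr
    linarith
  have k2 : X * Y * (2 * X * N) + X * Y * N + N ≤ Y * Y * (2 * X * N) := by
    have : X * Y * (N : ℤ) * (X + 1) ≤ X * Y * N * Y := by gcongr; omega
    have : 1 * (N : ℤ) ≤ X * Y * N := by gcongr
    linarith
  have cx : ∀ j < N, (((x0 + X * X * (2 * X * N + j)).toNat : ℕ) : ℤ) =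
      x0 + X * X * (2 * X * N + j) := fun j hj => by
    rw [Int.toNat_of_nonneg]; have := bx j hj; omega
  have cy : ∀ j < N, (((y0 + X * Y * (2 * X * N + j)).toNat : ℕ) : ℤ) =
      y0 + X * Y * (2 * X * N + j) := fun j hj => by
    rw [Int.toNat_of_nonneg]; have := bY j hj; linarith [mul_nonneg (by positivity : 0 ≤ X * X) hNN]
  have cz : ∀ j < N, (((z0 + Y * Y * (2 * X * N + j)).toNat : ℕ) : ℤ) =
      z0 + Y * Y * (2 * X * N + j) := fun j hj => by
    rw [Int.toNat_of_nonneg]; have := bz j hj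
    linarith [mul_nonneg (by positivity : 0 ≤ X * X) hNN,
      mul_nonneg (by positivity : 0 ≤ X * Y) hNN]
  refine ⟨fun j => (x0 + X * X * (2 * X * N + j)).toNat,
    fun j => (y0 + X * Y * (2 * X * N + j)).toNat,
    fun j => (z0 + Y * Y * (2 * X * N + j)).toNat, ?_, ?_, ?_⟩
  · intro j hj
    have := bx j hj
    have hz := bz j hj
    refine ⟨?_, ?_, ?_, ?_⟩
    · zify; rw [cx j hj]; linarith
    · zify
      rw [cz j hj, Int.toNat_of_nonneg (by positivity)]
      linarith
    · simp only [cx j hj, cy j hj]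
      linear_combination e1 + X * (2 * X * N + j) * h
    · simp only [cy j hj, cz j hj]
      linear_combination e2 + Y * (2 * X * N + j) * h
  · intro i hi j hj
    have := bx i hi
    have := bY i hi
    have := bY j hj
    have := bz j hj
    constructor
    · zify; rw [cx i hi, cy j hj]; linarith
    · zify; rw [cy i hi, cz j hj]; linarith
  · intro i hi j hj hij
    have key : ∀ c U : ℤ, 1 ≤ U → c + U * (2 * X * N + i) ≠ c + U * (2 * X * N + j) := by
      intro c U hU he
      have : U * ((i : ℤ) - j) = 0 := by linarith
      rcases mul_eq_zero.mp this with h | h <;> omega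
    refine ⟨?_, ?_, ?_⟩
    · zify; rw [cx i hi, cx j hj]; exact key _ _ hXX
    · zify; rw [cy i hi, cy j hj]; exact key _ _ hXYp
    · zify; rw [cz i hi, cz j hj]; exact key _ _ hYY

lemma maker_bound_lt (a₁ a₂ b : ℤ) (h₁ : a₁ ≠ 0)
    (hAb : ∃ x y : ℤ, a₁ * x + a₂ * y = b) (X Y : ℤ) (hX : 0 < X) (hXY : X < Y)
    (h : a₁ * X + a₂ * Y = 0) (win : Finset ℕ → Prop)
    (hmono : ∀ M M', M ⊆ M' → win M → win M')
    (hwin : ∀ x y : ℕ, x ≠ y → a₁ * (x : ℤ) + a₂ * (y : ℤ) = b → win {x, y}) :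
    ∃ K N0 : ℕ, 0 < K ∧ ∀ N ≥ N0, ∀ n ≥ K * N, ∀ p : ℝ, 0 ≤ p → p ≤ 1 →
      1 - (1 - p ^ 3) ^ N ≤ probRandomSubset n p (MakerWins win) := by
  obtain ⟨K, N0, hK, H⟩ := triples_lt a₁ a₂ b h₁ hAb X Y hX hXY h
  refine ⟨K, N0, hK, fun N hN n hn p hp0 hp1 => ?_⟩
  obtain ⟨x, y, z, h1, h2, h3⟩ := H N hN
  have hnone := prob_none n p N (fun j => {x j, y j, z j}) ?_ ?_ ?_
  · rw [← hnone, prob_not n p (MakerWins win)]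
    gcongr
    refine prob_mono n p hp0 hp1 _ _ fun S _ hS j hj hsub => hS ?_
    have hlt := h2 j hj j hj
    have hh := h1 j hj
    refine makerWins_of_path hmono S (x j) (y j) (z j) (hsub (by simp)) (hsub (by simp))
      (hsub (by simp)) (by omega) (by omega) (by omega) ?_ ?_
    · exact hwin _ _ (by omega) hh.2.2.1
    · exact hwin _ _ (by omega) hh.2.2.2
  · intro j hj w hw
    have hlt := h2 j hj j hj
    have hh := h1 j hj
    simp only [Finset.mem_insert, Finset.mem_singleton] at hw
    rw [Finset.mem_Icc]
    omega
  · intro j hj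
    have hlt := h2 j hj j hj
    rw [Finset.card_eq_three]
    exact ⟨x j, y j, z j, by omega, by omega, by omega, rfl⟩
  · intro i hi j hj hij
    have l1 := h2 i hi j hj
    have l2 := h2 j hj i hi
    have l3 := h3 i hi j hj hij
    have l4 := h2 i hi i hi
    have l5 := h2 j hj j hj
    rw [Finset.disjoint_left]
    intro w hw hw'
    simp only [Finset.mem_insert, Finset.mem_singleton] at hw hw'
    rcases hw with hw | hw | hw <;> rcases hw' with hw' | hw' | hw' <;> omega

lemma breaker_bound (a₁ a₂ b : ℤ) (h₁ : a₁ ≠ 0) (h₂ : a₂ ≠ 0) (hne : a₁ ≠ a₂)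
    (n : ℕ) (p : ℝ) (hp0 : 0 ≤ p) (hp1 : p ≤ 1) :
    1 - n * p ^ 3 ≤ probRandomSubset n p (fun S =>
      BreakerWinsRado (Matrix.of fun _ : Fin 1 => ![a₁, a₂]) (fun _ => b) S) := by
  let E : ℕ → Finset ℕ → Prop := fun y S => ∃ x z : ℕ, x ∈ S ∧ y ∈ S ∧ z ∈ S ∧
    x ≠ y ∧ y ≠ z ∧ a₁ * (x : ℤ) + a₂ * (y : ℤ) = b ∧ a₁ * (y : ℤ) + a₂ * (z : ℤ) = b
  have hE : ∀ y ∈ Finset.Icc 1 n, probRandomSubset n p (E y) ≤ p ^ 3 := by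
    intro y hy
    by_cases hex : E y (Finset.Icc 1 n)
    · obtain ⟨x, z, hx, _, hz, hxy, hyz, e1, e2⟩ := hex
      have hxz : x ≠ z := by
        rintro rfl
        have : (a₁ - a₂) * ((x : ℤ) - y) = 0 := by linear_combination e1 - e2
        rcases mul_eq_zero.mp this with h | h
        · exact hne (by omega)
        · omega
      have hcard : ({x, y, z} : Finset ℕ).card = 3 :=
        Finset.card_eq_three.mpr ⟨x, y, z, hxy, hxz, hyz, rfl⟩
      rw [← hcard, ← prob_superset n p {x, y, z}
        (by intro w hw; simp only [Finset.mem_insert, Finset.mem_singleton] at hw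
            rcases hw with rfl | rfl | rfl <;> assumption)]
      refine prob_mono n p hp0 hp1 _ _ ?_
      rintro S _ ⟨x', z', hx', hy', hz', _, _, e1', e2'⟩
      have hxx : x' = x := by
        have : a₁ * (x' : ℤ) = a₁ * x := by linear_combination e1' - e1
        exact_mod_cast mul_left_cancel₀ h₁ this
      have hzz : z' = z := by
        have : a₂ * (z' : ℤ) = a₂ * z := by linear_combination e2' - e2
        exact_mod_cast mul_left_cancel₀ h₂ this
      subst hxx hzz
      intro w hw
      simp only [Finset.mem_insert, Finset.mem_singleton] at hw
      rcases hw with rfl | rfl | rfl <;> assumption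
    · have : probRandomSubset n p (E y) = 0 := by
        refine Finset.sum_eq_zero fun S hS => ?_
        rw [Finset.mem_powerset] at hS
        rw [if_neg]
        rintro ⟨x, z, hx, hy, hz, h⟩
        exact hex ⟨x, z, hS hx, hS hy, hS hz, h⟩
      rw [this]
      positivity
  have hU := (prob_union n p hp0 hp1 (Finset.Icc 1 n) E).trans (Finset.sum_le_sum hE)
  simp only [Finset.sum_const, Nat.card_Icc, nsmul_eq_mul, Nat.add_sub_cancel] at hU
  rw [prob_not]
  refine sub_le_sub_left (le_trans (prob_mono n p hp0 hp1 _ _ ?_) hU) 1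
  intro S hS hB
  by_contra hno
  have hno' : ∀ y, ¬ E y S := fun y hy => hno ⟨y, by
    obtain ⟨_, _, _, h, _⟩ := hy
    exact hS h, hy⟩
  refine hB ?_
  refine breakerWinsAux_of_matching
    (fun u v => u ≠ v ∧ (a₁ * (u : ℤ) + a₂ * (v : ℤ) = b ∨ a₁ * (v : ℤ) + a₂ * (u : ℤ) = b))
    ?_ ?_ ?_ S.card S ∅ le_rfl (by simp) (by simp) ?_
  · rintro u v ⟨h, h'⟩
    exact ⟨h.symm, h'.symm⟩
  · rintro u ⟨h, _⟩
    exact h rfl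
  · intro M hM
    rw [radoWin_iff] at hM
    obtain ⟨x, hx, y, hy, hxy, h⟩ := hM
    exact ⟨x, hx, y, hy, hxy, Or.inl h⟩
  · rintro u hu v hv w hw ⟨huv, e⟩ ⟨huw, f⟩
    rcases e with e | e <;> rcases f with f | f
    · have : a₂ * (v : ℤ) = a₂ * w := by linear_combination e - f
      exact_mod_cast mul_left_cancel₀ h₂ this
    · exact absurd ⟨w, v, hw, hu, hv, huw.symm, huv, f, e⟩ (hno' u)
    · exact absurd ⟨v, w, hv, hu, hw, huv.symm, huw, e, f⟩ (hno' u)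
    · have : a₁ * (v : ℤ) = a₁ * w := by linear_combination e - f
      exact_mod_cast mul_left_cancel₀ h₁ this

lemma cube_eq (n : ℕ) (p : ℝ) : (p * (n : ℝ) ^ ((1 : ℝ) / 3)) ^ 3 = n * p ^ 3 := by
  have : ((n : ℝ) ^ ((1 : ℝ) / 3)) ^ 3 = n := by
    rw [← Real.rpow_natCast, ← Real.rpow_mul (Nat.cast_nonneg n)]
    norm_num
  rw [mul_pow, this, mul_comm]

lemma maker_bound (a₁ a₂ b : ℤ) (h₁ : a₁ ≠ 0) (h₂ : a₂ ≠ 0)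
    (hAb : ∃ x y : ℕ, 0 < x ∧ 0 < y ∧ x ≠ y ∧ a₁ * (x : ℤ) + a₂ * (y : ℤ) = b)
    (hA : ∃ x y : ℕ, 0 < x ∧ 0 < y ∧ x ≠ y ∧ a₁ * (x : ℤ) + a₂ * (y : ℤ) = 0) :
    ∃ K N0 : ℕ, 0 < K ∧ ∀ N ≥ N0, ∀ n ≥ K * N, ∀ p : ℝ, 0 ≤ p → p ≤ 1 →
      1 - (1 - p ^ 3) ^ N ≤ probRandomSubset n p (fun S =>
          MakerWinsRado (Matrix.of fun _ : Fin 1 => ![a₁, a₂]) (fun _ => b) S) := by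
  obtain ⟨x, y, _, _, _, hb⟩ := hAb
  obtain ⟨X, Y, hX, hY, hXY, h0⟩ := hA
  have hmono : ∀ M M', M ⊆ M' →
      RadoWin (Matrix.of fun _ : Fin 1 => ![a₁, a₂]) (fun _ => b) M →
      RadoWin (Matrix.of fun _ : Fin 1 => ![a₁, a₂]) (fun _ => b) M' := by
    rintro M M' hMM ⟨x, hx, hM, h⟩
    exact ⟨x, hx, fun i => hMM (hM i), h⟩
  rcases lt_or_gt_of_ne hXY with hlt | hlt
  · refine maker_bound_lt a₁ a₂ b h₁ ⟨x, y, hb⟩ X Y (by omega) (by omega) h0 _ hmono ?_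
    intro u v huv e
    exact (radoWin_iff _ _ _ _).mpr ⟨u, by simp, v, by simp, huv, e⟩
  · refine maker_bound_lt a₂ a₁ b h₂ ⟨y, x, by linarith⟩ Y X (by omega) (by omega)
      (by linarith) _ hmono ?_
    intro u v huv e
    exact (radoWin_iff _ _ _ _).mpr ⟨v, by simp, u, by simp, huv.symm, by linarith⟩

end helpers

/-- Theorem 1.2(ii) of the paper. For a single linear equation
`a₁x₁ + a₂x₂ = b` in two variables with nonzero coefficients, where both the pair `(A,b)`
and the matrix `A` are irredundant (so `A` does not satisfy (*)), the `(A,b)`-game on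
`[n]_p` is Maker's win w.h.p. if `p ≫ n^{-1/3}` and Breaker's win w.h.p. if `p ≪ n^{-1/3}`. -/
theorem two_variable_equation_threshold (a₁ a₂ : ℤ) (h₁ : a₁ ≠ 0) (h₂ : a₂ ≠ 0) (b : ℤ)
    (hAb : ∃ x y : ℕ, 0 < x ∧ 0 < y ∧ x ≠ y ∧ a₁ * (x : ℤ) + a₂ * (y : ℤ) = b)
    (hA : ∃ x y : ℕ, 0 < x ∧ 0 < y ∧ x ≠ y ∧ a₁ * (x : ℤ) + a₂ * (y : ℤ) = 0)
    (p : ℕ → ℝ) (hp : ∀ n, 0 ≤ p n ∧ p n ≤ 1) :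
    (Filter.Tendsto (fun n : ℕ => p n * (n : ℝ) ^ ((1 : ℝ) / 3)) Filter.atTop Filter.atTop →
      Filter.Tendsto
        (fun n => probRandomSubset n (p n) (fun S =>
          MakerWinsRado (Matrix.of fun _ : Fin 1 => ![a₁, a₂]) (fun _ => b) S))
        Filter.atTop (nhds 1)) ∧
    (Filter.Tendsto (fun n : ℕ => p n * (n : ℝ) ^ ((1 : ℝ) / 3)) Filter.atTop (nhds 0) →
      Filter.Tendsto
        (fun n => probRandomSubset n (p n) (fun S =>
          BreakerWinsRado (Matrix.of fun _ : Fin 1 => ![a₁, a₂]) (fun _ => b) S))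
        Filter.atTop (nhds 1)) := by
  constructor
  · intro hlim
    obtain ⟨K, N0, hK, H⟩ := maker_bound a₁ a₂ b h₁ h₂ hAb hA
    have hK' : (0 : ℝ) < K := by exact_mod_cast hK
    have hcube : Filter.Tendsto (fun n : ℕ => (n : ℝ) * p n ^ 3) Filter.atTop Filter.atTop := by
      have := (Filter.tendsto_pow_atTop (α := ℝ) (n := 3) (by norm_num)).comp hlim
      refine this.congr fun n => ?_
      exact cube_eq n (p n)
    have hexp : Filter.Tendsto
        (fun n : ℕ => 1 - Real.exp (-((n : ℝ) * p n ^ 3 * (1 / (2 * K))))) Filter.atTop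
        (nhds 1) := by
      have h := Real.tendsto_exp_neg_atTop_nhds_zero.comp
        (hcube.atTop_mul_const (by positivity : (0 : ℝ) < 1 / (2 * K)))
      have := h.const_sub 1
      simpa using this
    refine tendsto_of_tendsto_of_tendsto_of_le_of_le' hexp tendsto_const_nhds ?_ ?_
    · filter_upwards [Filter.eventually_ge_atTop (K * (N0 + 1))] with n hn
      obtain ⟨hp0, hp1⟩ := hp n
      have hq : N0 + 1 ≤ n / K := by
        rw [Nat.le_div_iff_mul_le hK]
        linarith [mul_comm K (N0 + 1)]
      refine le_trans ?_ (H (n / K) (by omega) n (Nat.mul_div_le n K) (p n) hp0 hp1)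
      gcongr
      have hp3 : 0 ≤ p n ^ 3 := by positivity
      have hp31 : p n ^ 3 ≤ 1 := pow_le_one₀ hp0 hp1
      have hN : (n : ℝ) * (1 / (2 * K)) ≤ ((n / K : ℕ) : ℝ) := by
        have h1 : n < K * (n / K) + K := by
          have := Nat.div_add_mod n K
          have := Nat.mod_lt n hK
          omega
        have h2 : K * 1 ≤ K * (n / K) := Nat.mul_le_mul_left K (by omega)
        have h3 : n ≤ 2 * K * (n / K) := by
          rw [mul_assoc]; omega
        have h4 : (n : ℝ) ≤ 2 * K * ((n / K : ℕ) : ℝ) := by exact_mod_cast h3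
        rw [mul_one_div, div_le_iff₀ (by positivity)]
        linarith
      calc (1 - p n ^ 3) ^ (n / K) ≤ (Real.exp (-(p n ^ 3))) ^ (n / K) := by
            gcongr
            exact Real.one_sub_le_exp_neg _
        _ = Real.exp (-(((n / K : ℕ) : ℝ) * p n ^ 3)) := by
            rw [← Real.exp_nat_mul]
            congr 1
            ring
        _ ≤ _ := by
            apply Real.exp_le_exp.mpr
            have := mul_le_mul_of_nonneg_right hN hp3
            linarith
    · exact Filter.Eventually.of_forall fun n => prob_le_one n _ (hp n).1 (hp n).2 _
  · intro hlim
    have hne : a₁ ≠ a₂ := by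
      rintro rfl
      obtain ⟨X, Y, hX, hY, _, h0⟩ := hA
      have : a₁ * ((X : ℤ) + Y) = 0 := by linarith
      rcases mul_eq_zero.mp this with h | h
      · exact h₁ h
      · omega
    have hcube : Filter.Tendsto (fun n : ℕ => 1 - (n : ℝ) * p n ^ 3) Filter.atTop (nhds 1) := by
      have := (hlim.pow 3).const_sub 1
      simp only [cube_eq] at this
      simpa using this
    exact tendsto_of_tendsto_of_tendsto_of_le_of_le hcube tendsto_const_nhds
      (fun n => breaker_bound a₁ a₂ b h₁ h₂ hne n (p n) (hp n).1 (hp n).2)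
      (fun n => prob_le_one n _ (hp n).1 (hp n).2 _)
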